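/- Let a ∈ ℝ and let R be an algebraic curvature tensor on ℝ³ with ric 2 3 = 0. Define the linear endomorphism S₀ of the 6-dimensional real vector space of symmetric 3×3 real matrices by S₀(h) i k = a · δ i 1 · Σ_{s,u} (R k s 1 u) · h s u − a · Σ_u (R k 1 1 u) · h i u + a · δ k 1 · Σ_{s,u} (R i s 1 u) · h s u − a · Σ_u (R i 1 1 u) · h k u. Then the characteristic polynomial of S₀ equals X³ · (X − μ₁) · (X − μ₂) · (X − μ₃), where μ₁ = a·(scal − 2·ric 3 3), μ₂ = a·(scal − 2·ric 2 2), and μ₃ = a·ric 1 1. -/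

import Mathlib

open Finset Polynomial

/-- The submodule of symmetric `n × n` real matrices. -/
def symMatrices (n : ℕ) : Submodule ℝ (Matrix (Fin n) (Fin n) ℝ) where
  carrier := {A | A.IsSymm}
  add_mem' := fun ha hb => ha.add hb
  zero_mem' := Matrix.isSymm_zero
  smul_mem' := fun c _ hA => hA.smul c

/-- Coordinates on the symmetric `3 × 3` matrices, ordered so that the lower right
`2 × 2` block comes last, with its off-diagonal entry at the end. -/
def symMatricesThreeEquiv : symMatrices 3 ≃ₗ[ℝ] (Fin 6 → ℝ) where
  toFun h := ![h.1 0 0, h.1 0 1, h.1 0 2, h.1 1 1, h.1 2 2, h.1 1 2]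
  map_add' h h' := by ext i; fin_cases i <;> rfl
  map_smul' c h := by ext i; fin_cases i <;> rfl
  invFun v := ⟨!![v 0, v 1, v 2; v 1, v 3, v 5; v 2, v 5, v 4], by
    ext i j; fin_cases i <;> fin_cases j <;> rfl⟩
  left_inv h := by
    have hs : ∀ i j, h.1 j i = h.1 i j := fun i j => Matrix.IsSymm.apply h.2 i j
    ext i j
    fin_cases i <;> fin_cases j <;> simp [hs 0 1, hs 0 2, hs 1 2]
  right_inv v := by ext i; fin_cases i <;> rfl

/-- **Characteristic polynomial of the principal symbol of the linearized
purely quadratic operator `L₀` (RG²ₐ⁰-flow).**  Let `R` be an algebraic curvature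
tensor on `ℝ³` (components in the standard orthonormal basis; Lean indices
`0, 1, 2` correspond to the indices `1, 2, 3` of the text) with `ric 2 3 = 0`,
and let `S₀` be the corresponding principal symbol on the 6-dimensional space of
symmetric `3 × 3` matrices.  Then the characteristic polynomial of `S₀` is
`X³ (X − μ₁)(X − μ₂)(X − μ₃)` with `μ₁ = a(scal − 2 ric 3 3)`,
`μ₂ = a(scal − 2 ric 2 2)`, `μ₃ = a ric 1 1`. -/
theorem charpoly_symbol_RG2a0
    (a : ℝ) (R : Fin 3 → Fin 3 → Fin 3 → Fin 3 → ℝ)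
    (hR1 : ∀ i j k l, R i j k l = -R j i k l)
    (hR2 : ∀ i j k l, R i j k l = -R i j l k)
    (hR3 : ∀ i j k l, R i j k l = R k l i j)
    (ric : Fin 3 → Fin 3 → ℝ) (hric : ∀ i k, ric i k = ∑ j, R i j k j)
    (scal : ℝ) (hscal : scal = ∑ i, ric i i)
    (hric23 : ric 1 2 = 0)
    (S₀ : symMatrices 3 →ₗ[ℝ] symMatrices 3)
    (hS₀ : ∀ h : symMatrices 3, ∀ i k,
      (S₀ h : Matrix (Fin 3) (Fin 3) ℝ) i k =
        a * (if i = 0 then (1 : ℝ) else 0) *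
            (∑ s, ∑ u, R k s 0 u * (h : Matrix (Fin 3) (Fin 3) ℝ) s u)
          - a * (∑ u, R k 0 0 u * (h : Matrix (Fin 3) (Fin 3) ℝ) i u)
          + a * (if k = 0 then (1 : ℝ) else 0) *
              (∑ s, ∑ u, R i s 0 u * (h : Matrix (Fin 3) (Fin 3) ℝ) s u)
          - a * (∑ u, R i 0 0 u * (h : Matrix (Fin 3) (Fin 3) ℝ) k u)) :
    LinearMap.charpoly S₀ =
      X ^ 3 * (X - C (a * (scal - 2 * ric 2 2)))
            * (X - C (a * (scal - 2 * ric 1 1)))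
            * (X - C (a * ric 0 0)) := by
  have hl : ∀ i k l, R i i k l = 0 := fun i k l => self_eq_neg.mp (hR1 i i k l)
  have hr : ∀ i k l, R k l i i = 0 := fun i k l => self_eq_neg.mp (hR2 k l i i)
  have hD : R 0 1 0 2 = 0 := by
    simpa [hric, Fin.sum_univ_three, hl, hr, hR1 1 0, hR2 _ _ 2 0] using hric23
  have hD' : R 0 2 0 1 = 0 := hR3 0 2 0 1 ▸ hD
  let b := Module.Basis.ofEquivFun symMatricesThreeEquiv
  have hM : ∀ i j, LinearMap.toMatrix b b S₀ i j =
      symMatricesThreeEquiv (S₀ (symMatricesThreeEquiv.symm (Pi.single j 1))) i := by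
    intro i j
    simp [b, LinearMap.toMatrix_apply]
  have htri : (LinearMap.toMatrix b b S₀).IsUpperTriangular := by
    intro i j hij
    rw [hM]
    fin_cases i <;> fin_cases j <;> first
      | exact absurd hij (by decide)
      | simp [symMatricesThreeEquiv, hS₀, Fin.sum_univ_three, hl, hr, hR1 1 0, hR1 2 0, hR1 2 1,
          hD, hD']
  have hdiag : ∀ i, LinearMap.toMatrix b b S₀ i i =
      ![0, 0, 0, a * (2 * R 0 1 0 1), a * (2 * R 0 2 0 2), a * (R 0 1 0 1 + R 0 2 0 2)] i := by
    intro i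
    rw [hM]
    fin_cases i <;>
      simp [symMatricesThreeEquiv, hS₀, Fin.sum_univ_three, hl, hr, hR1 1 0, hR1 2 0, hR1 2 1,
        hD, hD'] <;> ring
  have h₀ : ric 0 0 = R 0 1 0 1 + R 0 2 0 2 := by
    simp [hric, Fin.sum_univ_three, hl]
  have h₁ : scal - 2 * ric 1 1 = 2 * R 0 2 0 2 := by
    simp [hscal, hric, Fin.sum_univ_three, hl, hR1 1 0, hR1 2 0, hR1 2 1,
      hR2 _ _ 1 0, hR2 _ _ 2 0, hR2 _ _ 2 1]
    ring
  have h₂ : scal - 2 * ric 2 2 = 2 * R 0 1 0 1 := by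
    simp [hscal, hric, Fin.sum_univ_three, hl, hR1 1 0, hR1 2 0, hR1 2 1,
      hR2 _ _ 1 0, hR2 _ _ 2 0, hR2 _ _ 2 1]
    ring
  rw [← LinearMap.charpoly_toMatrix S₀ b, Matrix.charpoly_of_isUpperTriangular _ htri, h₀, h₁, h₂]
  simp only [hdiag, Fin.prod_univ_six, Matrix.cons_val, C_0]
  ring
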